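/- arXiv:2508.05517 — 3 statements merged into one kernel-verified Lean document; each statement's English description precedes it below -/
import Mathlib

section
/- Let ε > 0 and let (a_j) and (λ_j) be real sequences such that the series Σ_j a_j² e^{−2λ_j t} converges for every t ∈ [0,2], and such that for every index j with a_j ≠ 0 one has either λ_j = 0 or |λ_j| ≥ 3ε (spectral gap around 0). Then there exists δ > 0, depending only on ε, such that for every δ₁ ∈ (0, δ) there exists δ₂ > δ₁, depending only on δ₁ and ε, with the following property: for every pair of sequences (a_j), (λ_j) as above, if I(1) ≥ e^{δ₁} I(0), then I(2) ≥ e^{δ₂} I(1). -/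
/-- The Gaussian-weighted L² norm at time `t` of the solution
`u(·,t) = Σ_j a_j e^{−λ_j t} φ_j` in spectral form:
`I(t) = (Σ_j a_j² e^{−2 λ_j t})^{1/2}`. -/
noncomputable def specI (a l : ℕ → ℝ) (t : ℝ) : ℝ :=
  Real.sqrt (∑' j, a j ^ 2 * Real.exp (-2 * l j * t))

/-- Squaring turns a growth bound between square roots into one between the radicands. -/
theorem exp_mul_sqrt_le_sqrt_iff {d x y : ℝ} (hx : 0 ≤ x) (hy : 0 ≤ y) :
    Real.exp d * Real.sqrt x ≤ Real.sqrt y ↔ Real.exp (2 * d) * x ≤ y := by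
  rw [Real.le_sqrt (by positivity) hy, mul_pow, Real.sq_sqrt hx, ← Real.exp_nat_mul]
  norm_num

/-- With a gap in the spectrum, `x = e^{−2l}` avoids the open interval `(1, e^{6ε})`. -/
theorem exp_sub_one_mul_exp_sub_nonneg {ε l : ℝ} (hε : 0 < ε) (h : l = 0 ∨ 3 * ε ≤ |l|) :
    0 ≤ (Real.exp (-2 * l) - 1) * (Real.exp (-2 * l) - Real.exp (6 * ε)) := by
  have hq : 1 ≤ Real.exp (6 * ε) := Real.one_le_exp (by positivity)
  rcases h with rfl | h
  · simp
  · rcases le_abs.mp h with h | h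
    · have : Real.exp (-2 * l) ≤ 1 := Real.exp_le_one_iff.mpr (by linarith)
      exact mul_nonneg_of_nonpos_of_nonpos (by linarith) (by linarith)
    · have : Real.exp (6 * ε) ≤ Real.exp (-2 * l) := Real.exp_le_exp.mpr (by linarith)
      exact mul_nonneg (by linarith) (by linarith)

/-- The quadratic inequality between the squared norms at times `0`, `1`, `2`. -/
theorem tsum_growth_of_gap {ε : ℝ} (hε : 0 < ε) {a l : ℕ → ℝ}
    (hs : ∀ t ∈ Set.Icc (0 : ℝ) 2, Summable (fun j => a j ^ 2 * Real.exp (-2 * l j * t)))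
    (hgap : ∀ j, a j ≠ 0 → l j = 0 ∨ 3 * ε ≤ |l j|) :
    (1 + Real.exp (6 * ε)) * ∑' j, a j ^ 2 * Real.exp (-2 * l j * 1) ≤
      ∑' j, a j ^ 2 * Real.exp (-2 * l j * 2) +
        Real.exp (6 * ε) * ∑' j, a j ^ 2 * Real.exp (-2 * l j * 0) := by
  have h0 := hs 0 (by norm_num)
  have h1 := hs 1 (by norm_num)
  have h2 := hs 2 (by norm_num)
  rw [← tsum_mul_left, ← tsum_mul_left, ← h2.tsum_add (h0.mul_left _)]
  refine (h1.mul_left _).tsum_le_tsum (fun j => ?_) (h2.add (h0.mul_left _))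
  by_cases ha : a j = 0
  · simp [ha]
  · have h := mul_nonneg (sq_nonneg (a j)) (exp_sub_one_mul_exp_sub_nonneg hε (hgap j ha))
    have hsq : Real.exp (-2 * l j * 2) = Real.exp (-2 * l j) ^ 2 := by
      rw [← Real.exp_nat_mul]
      congr 1
      push_cast
      ring
    rw [hsq, mul_one, mul_zero, Real.exp_zero]
    linarith

/-- Spectral form of the paper's Lemma 5.7 (three-annulus growth propagation):
given a spectral gap `(−3ε, 3ε) \ {0}` for the eigenvalues of the components of
the solution, there is `δ > 0`, depending only on `ε`, such that for every
`δ₁ ∈ (0, δ)` there is `δ₂ > δ₁`, depending only on `δ₁` and `ε`, such that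
`I(1) ≥ e^{δ₁} I(0)` implies `I(2) ≥ e^{δ₂} I(1)`. -/
theorem stmt_0 (ε : ℝ) (hε : 0 < ε) :
    ∃ δ > (0 : ℝ), ∀ δ₁ : ℝ, 0 < δ₁ → δ₁ < δ →
      ∃ δ₂ > δ₁, ∀ (a l : ℕ → ℝ),
        (∀ t ∈ Set.Icc (0 : ℝ) 2,
          Summable (fun j => a j ^ 2 * Real.exp (-2 * l j * t))) →
        (∀ j, a j ≠ 0 → l j = 0 ∨ 3 * ε ≤ |l j|) →
        specI a l 1 ≥ Real.exp δ₁ * specI a l 0 →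
        specI a l 2 ≥ Real.exp δ₂ * specI a l 1 := by
  refine ⟨3 * ε, by positivity, fun δ₁ hδ₁ hδ => ?_⟩
  have hA : 1 < Real.exp (2 * δ₁) := Real.one_lt_exp_iff.mpr (by positivity)
  have hAq : Real.exp (2 * δ₁) < Real.exp (6 * ε) := Real.exp_lt_exp.mpr (by linarith)
  set A := Real.exp (2 * δ₁) with hA_def
  set q := Real.exp (6 * ε) with hq_def
  have hA0 : 0 < A := by linarith
  have hB : A < 1 + q - q / A := by
    have h : 1 + q - q / A - A = (q - A) * (A - 1) / A := by
      field_simp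
      ring
    have : 0 < (q - A) * (A - 1) / A :=
      div_pos (mul_pos (by linarith) (by linarith)) hA0
    linarith
  have hexp : Real.exp (2 * (Real.log (1 + q - q / A) / 2)) = 1 + q - q / A := by
    rw [mul_div_cancel₀ _ two_ne_zero, Real.exp_log (by linarith)]
  refine ⟨Real.log (1 + q - q / A) / 2, ?_, fun a l hs hgap hI => ?_⟩
  · have : Real.exp (2 * δ₁) < Real.exp (2 * (Real.log (1 + q - q / A) / 2)) := by
      rw [hexp]
      exact hB
    linarith [Real.exp_lt_exp.mp this]
  · have hnn (t : ℝ) : 0 ≤ ∑' j, a j ^ 2 * Real.exp (-2 * l j * t) :=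
      tsum_nonneg fun j => by positivity
    have hquad := tsum_growth_of_gap hε hs hgap
    unfold specI at hI ⊢
    rw [ge_iff_le, exp_mul_sqrt_le_sqrt_iff (hnn _) (hnn _)] at hI ⊢
    rw [hexp]
    rw [← hA_def] at hI
    rw [← hq_def] at hquad
    have h := mul_le_mul_of_nonneg_left hI (show 0 ≤ q / A by positivity)
    rw [← mul_assoc, div_mul_cancel₀ _ hA0.ne'] at h
    linarith
end

section
/- Let ε > 0 and let (a_j) and (λ_j) be real sequences such that the series Σ_j a_j² e^{−2λ_j t} converges for t = 0, 1, 2, and such that |λ_j| ≥ ε for every index j with a_j ≠ 0 (no component with eigenvalue in (−ε, ε)). Then, with δ := (1/2)·log(cosh(2ε)) > 0, at least one of the following holds: I(2) ≥ e^{δ} I(1), or I(0) ≥ e^{δ} I(1). -/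
/-- Convexity of `t ↦ e^{−2xt}`, quantified by a spectral gap. -/
theorem two_mul_cosh_mul_exp_le {ε x : ℝ} (hε : 0 < ε) (hx : ε ≤ |x|) :
    2 * Real.cosh (2 * ε) * Real.exp (-2 * x * 1) ≤
      Real.exp (-2 * x * 2) + Real.exp (-2 * x * 0) := by
  have hc : Real.cosh (2 * ε) ≤ Real.cosh (2 * x) := by
    rw [Real.cosh_le_cosh, abs_mul, abs_mul, abs_of_pos hε]
    gcongr
  calc 2 * Real.cosh (2 * ε) * Real.exp (-2 * x * 1)
      ≤ 2 * Real.cosh (2 * x) * Real.exp (-2 * x * 1) := by gcongr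
    _ = Real.exp (2 * x) * Real.exp (-2 * x * 1)
          + Real.exp (-(2 * x)) * Real.exp (-2 * x * 1) := by
        rw [Real.cosh_eq]; ring
    _ = Real.exp (-2 * x * 2) + Real.exp (-2 * x * 0) := by
        rw [← Real.exp_add, ← Real.exp_add, add_comm]
        ring_nf

/-- Spectral form of the paper's Lemma 5.8: if the solution has no component
with eigenvalue in `(−ε, ε)`, then with `δ := (1/2) log (cosh (2ε)) > 0`, the
norm `I` grows by the factor `e^δ` either forward or backward in time. -/
theorem stmt_1 (ε : ℝ) (hε : 0 < ε) (a l : ℕ → ℝ)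
    (hsum : ∀ t ∈ ({0, 1, 2} : Set ℝ),
      Summable (fun j => a j ^ 2 * Real.exp (-2 * l j * t)))
    (hgap : ∀ j, a j ≠ 0 → ε ≤ |l j|) :
    0 < (1 / 2) * Real.log (Real.cosh (2 * ε)) ∧
      (specI a l 2 ≥ Real.exp ((1 / 2) * Real.log (Real.cosh (2 * ε))) * specI a l 1 ∨
        specI a l 0 ≥ Real.exp ((1 / 2) * Real.log (Real.cosh (2 * ε))) * specI a l 1) := by
  have hcosh : 1 < Real.cosh (2 * ε) := Real.one_lt_cosh.2 (by positivity)
  have hexp : Real.exp ((1 / 2) * Real.log (Real.cosh (2 * ε))) =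
      Real.sqrt (Real.cosh (2 * ε)) := by
    rw [Real.sqrt_eq_rpow, Real.rpow_def_of_pos (by positivity), mul_comm]
  refine ⟨mul_pos (by norm_num) (Real.log_pos hcosh), ?_⟩
  have h0 := hsum 0 (by simp)
  have h1 := hsum 1 (by simp)
  have h2 := hsum 2 (by simp)
  have key : 2 * Real.cosh (2 * ε) * ∑' j, a j ^ 2 * Real.exp (-2 * l j * 1) ≤
      (∑' j, a j ^ 2 * Real.exp (-2 * l j * 2)) + ∑' j, a j ^ 2 * Real.exp (-2 * l j * 0) := by
    rw [← tsum_mul_left, ← h2.tsum_add h0]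
    refine (h1.mul_left _).tsum_le_tsum (fun j => ?_) (h2.add h0)
    by_cases hj : a j = 0
    · simp [hj]
    · have := mul_le_mul_of_nonneg_left (two_mul_cosh_mul_exp_le hε (hgap j hj)) (sq_nonneg (a j))
      linarith
  rw [hexp]
  simp only [specI, ge_iff_le]
  rw [← Real.sqrt_mul (by positivity)]
  by_cases h : Real.cosh (2 * ε) * ∑' j, a j ^ 2 * Real.exp (-2 * l j * 1) ≤
      ∑' j, a j ^ 2 * Real.exp (-2 * l j * 2)
  · exact Or.inl (Real.sqrt_le_sqrt h)
  · exact Or.inr (Real.sqrt_le_sqrt (by linarith))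
end

section
/- Let ε > 0 and let L ≥ 2 be an integer. Let (a_j) and (λ_j) be real sequences such that the series Σ_j a_j² e^{−2λ_j t} converges for every t ∈ [0, 2L], and such that for every index j with a_j ≠ 0 one has either λ_j = 0 or |λ_j| ≥ 3ε. Let δ > 0 and, for δ₁ ∈ (0, δ), let δ₂ > δ₁ be the constants from the three-annulus lemma (spectral Lemma 5.7), depending only on ε and δ₁. Then at least one of the following two alternatives holds: either I(L−1) ≤ e^{(L−1)δ₁} I(0), or I(2L) ≥ e^{(L+1)δ₂} I(L−1). -/
/-- A real sequence whose first `n` steps grow by a factor at most `c ≥ 0` grows by at most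
`c ^ n`. -/
lemma le_pow_mul_of_step_le {f : ℕ → ℝ} {c : ℝ} (hc : 0 ≤ c) {n : ℕ}
    (h : ∀ k < n, f (k + 1) ≤ c * f k) : f n ≤ c ^ n * f 0 := by
  induction n with
  | zero => simp
  | succ n ih =>
    calc f (n + 1) ≤ c * f n := h n n.lt_succ_self
      _ ≤ c * (c ^ n * f 0) :=
        mul_le_mul_of_nonneg_left (ih fun k hk => h k (hk.trans n.lt_succ_self)) hc
      _ = c ^ (n + 1) * f 0 := by ring

/-- A real sequence whose `n` steps from `m` on grow by a factor at least `c ≥ 0` grows by at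
least `c ^ n`. -/
lemma pow_mul_le_of_le_step {f : ℕ → ℝ} {c : ℝ} (hc : 0 ≤ c) {m n : ℕ}
    (h : ∀ k < n, c * f (m + k) ≤ f (m + k + 1)) : c ^ n * f m ≤ f (m + n) := by
  induction n with
  | zero => simp
  | succ n ih =>
    calc c ^ (n + 1) * f m = c * (c ^ n * f m) := by ring
      _ ≤ c * f (m + n) :=
        mul_le_mul_of_nonneg_left (ih fun k hk => h k (hk.trans n.lt_succ_self)) hc
      _ ≤ f (m + (n + 1)) := h n n.lt_succ_self

/-- If growth by a factor `c` in one step forces growth by a factor `d ≥ c` in the next, then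
growth by `c` in step `k` propagates to growth by `d` in all later steps. -/
lemma le_step_of_le_step {f : ℕ → ℝ} {c d : ℝ} (hcd : c ≤ d) {N : ℕ} (hf : ∀ n, 0 ≤ f n)
    (h : ∀ k, k + 2 ≤ N → c * f k ≤ f (k + 1) → d * f (k + 1) ≤ f (k + 2))
    {k : ℕ} (hk : c * f k ≤ f (k + 1)) {m : ℕ} (hkm : k ≤ m) (hm : m + 2 ≤ N) :
    d * f (m + 1) ≤ f (m + 2) := by
  induction m, hkm using Nat.le_induction with
  | base => exact h k hm hk
  | succ m _ ih =>
    exact h (m + 1) hm ((mul_le_mul_of_nonneg_right hcd (hf _)).trans (ih (by omega)))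

/-- The key dichotomy in the proof of the paper's three-annulus Lemma 5.9:
assuming the spectral gap and the three-annulus property of Lemma 5.7 (with
constants `δ₁ < δ₂`), either `I` grows slowly on every unit step up to time
`L−1`, i.e. `I(L−1) ≤ e^{(L−1)δ₁} I(0)`, or the growth at rate `δ₂` propagates
and `I(2L) ≥ e^{(L+1)δ₂} I(L−1)`. -/
theorem stmt_7 (ε : ℝ) (hε : 0 < ε) (L : ℕ) (hL : 2 ≤ L) (a l : ℕ → ℝ)
    (hsum : ∀ t ∈ Set.Icc (0 : ℝ) (2 * (L : ℝ)),
      Summable (fun j => a j ^ 2 * Real.exp (-2 * l j * t)))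
    (hgap : ∀ j, a j ≠ 0 → l j = 0 ∨ 3 * ε ≤ |l j|)
    (δ δ₁ δ₂ : ℝ) (hδ : 0 < δ) (hδ₁ : 0 < δ₁) (hδ₁δ : δ₁ < δ) (hδ₂ : δ₁ < δ₂)
    (h3ann : ∀ t : ℝ, 0 ≤ t → t + 2 ≤ 2 * (L : ℝ) →
      specI a l (t + 1) ≥ Real.exp δ₁ * specI a l t →
      specI a l (t + 2) ≥ Real.exp δ₂ * specI a l (t + 1)) :
    specI a l ((L : ℝ) - 1) ≤ Real.exp (((L : ℝ) - 1) * δ₁) * specI a l 0 ∨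
      specI a l (2 * (L : ℝ)) ≥
        Real.exp (((L : ℝ) + 1) * δ₂) * specI a l ((L : ℝ) - 1) := by
  obtain ⟨M, rfl⟩ : ∃ M, L = M + 2 := ⟨L - 2, by omega⟩
  set f : ℕ → ℝ := fun n => specI a l n with hf_def
  have hf : ∀ n, 0 ≤ f n := fun n => Real.sqrt_nonneg _
  have hstep : ∀ k, k + 2 ≤ 2 * (M + 2) → Real.exp δ₁ * f k ≤ f (k + 1) →
      Real.exp δ₂ * f (k + 1) ≤ f (k + 2) := by
    intro k hk h
    have := h3ann k k.cast_nonneg (by exact_mod_cast hk)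
    simp only [hf_def, Nat.cast_add, Nat.cast_one, Nat.cast_ofNat] at h ⊢
    exact this h
  have hL1 : ((M + 2 : ℕ) : ℝ) - 1 = ((M + 1 : ℕ) : ℝ) := by push_cast; ring
  have hL2 : ((M + 2 : ℕ) : ℝ) + 1 = ((M + 3 : ℕ) : ℝ) := by push_cast; ring
  have hL3 : 2 * ((M + 2 : ℕ) : ℝ) = ((M + 1 + (M + 3) : ℕ) : ℝ) := by push_cast; ring
  rw [hL1, hL2, hL3, Real.exp_nat_mul, Real.exp_nat_mul]
  by_cases hgrow : ∃ k < M + 1, Real.exp δ₁ * f k ≤ f (k + 1)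
  · obtain ⟨k, hkM, hk⟩ := hgrow
    refine Or.inr (pow_mul_le_of_le_step (f := f) (Real.exp_pos δ₂).le fun i hi => ?_)
    have := le_step_of_le_step (Real.exp_le_exp.2 hδ₂.le) hf hstep hk
      (m := M + i) (by omega) (by omega)
    rwa [show M + 1 + i = M + i + 1 by omega]
  · push Not at hgrow
    left
    simpa [hf_def] using
      le_pow_mul_of_step_le (f := f) (Real.exp_pos δ₁).le fun k hk => (hgrow k hk).le
end
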